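/- In a quantum secret sharing scheme, any significant share has dimension at least the dimension of the secret. Precisely: let E be a channel from a system Q to systems U ⊗ S_j (an unauthorized set U together with one extra share S_j) such that (i) there is a decoding channel D from U ⊗ S_j recovering Q exactly (the union is authorized), and (ii) the marginal of E on U is a constant channel (U is unauthorized, i.e., its output is independent of the input). Then dim S_j ≥ dim Q. -/

import Mathlib

open Matrix

noncomputable section

/-- Apply a channel given by Kraus operators: `ρ ↦ ∑ i, K i * ρ * (K i)ᴴ`. -/
def applyKraus {ι n m : Type*} [Fintype ι] [Fintype n] [Fintype m]
    (K : ι → Matrix m n ℂ) (ρ : Matrix n n ℂ) : Matrix m m ℂ :=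
  ∑ i, K i * ρ * (K i)ᴴ

/-- Partial trace over the second tensor factor. -/
def ptraceSnd {U S : Type*} [Fintype U] [Fintype S]
    (ρ : Matrix (U × S) (U × S) ℂ) : Matrix U U ℂ :=
  Matrix.of fun i j => ∑ s : S, ρ (i, s) (j, s)

lemma applyKraus_single_apply {ι n m : Type*} [Fintype ι] [Fintype n] [Fintype m]
    [DecidableEq n] (K : ι → Matrix m n ℂ) (p q : n) (a b : m) :
    applyKraus K (Matrix.single p q 1) a b = ∑ i, K i a p * star (K i b q) := by
  simp [applyKraus, Matrix.sum_apply, Matrix.mul_apply, Matrix.single_apply, ite_and]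

lemma applyKraus_comp {ι κ l n m : Type*} [Fintype ι] [Fintype κ] [Fintype l] [Fintype n]
    [Fintype m] (D : κ → Matrix l m ℂ) (E : ι → Matrix m n ℂ) (ρ : Matrix n n ℂ) :
    applyKraus D (applyKraus E ρ) = applyKraus (fun k : κ × ι => D k.1 * E k.2) ρ := by
  simp only [applyKraus, Fintype.sum_prod_type, Matrix.mul_sum, Matrix.sum_mul,
    Matrix.conjTranspose_mul, Matrix.mul_assoc]

open scoped ComplexOrder in
/-- The Kraus operators of the identity channel are scalar. -/
lemma exists_eq_smul_one_of_applyKraus_eq_self {ι n : Type*} [Fintype ι] [Fintype n]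
    [DecidableEq n] [Nonempty n] (K : ι → Matrix n n ℂ) (h : ∀ ρ, applyKraus K ρ = ρ) (i : ι) :
    ∃ c : ℂ, K i = c • (1 : Matrix n n ℂ) := by
  have hK (p q a b : n) : ∑ i, K i a p * star (K i b q) = Matrix.single p q (1 : ℂ) a b := by
    rw [← applyKraus_single_apply, h]
  have hzero (f : ι → ℂ) (hf : ∑ i, f i * star (f i) = 0) : f i = 0 := by
    have : f ⬝ᵥ star f = 0 := hf
    exact congrFun (dotProduct_self_star_eq_zero.mp this) i
  obtain ⟨q⟩ := ‹Nonempty n›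
  refine ⟨K i q q, ?_⟩
  ext a b
  by_cases hab : a = b
  · subst hab
    have := hzero (fun i => K i a a - K i q q) (by
      simp only [star_sub, mul_sub, sub_mul, Finset.sum_sub_distrib, hK]
      simp)
    simpa using sub_eq_zero.mp this
  · have := hzero (fun i => K i a b) (by rw [hK]; simp [Ne.symm hab])
    simp [hab, this]

open scoped ComplexOrder in
/-- The positive semidefinite matrix `B * Bᴴ` has the same range as `B`. -/
lemma range_mulVecLin_self_mul_conjTranspose {m n : Type*} [Fintype m] [Fintype n]
    (B : Matrix m n ℂ) :
    LinearMap.range (B * Bᴴ).mulVecLin = LinearMap.range B.mulVecLin := by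
  refine Submodule.eq_of_le_of_finrank_eq ?_ (Matrix.rank_self_mul_conjTranspose B)
  rw [Matrix.mulVecLin_mul]
  exact LinearMap.range_comp_le_range _ _

section SecretSharing

variable {Q U S ιE ιD : Type*} [Fintype Q] [Fintype U] [Fintype S] [Fintype ιE] [Fintype ιD]
  [DecidableEq Q]

/-- Secrecy in coordinates: the marginal Choi matrix is a product. -/
lemma sum_mul_star_eq_of_ptraceSnd_eq (E : ιE → Matrix (U × S) Q ℂ) (σ : Matrix U U ℂ)
    (hsec : ∀ ρ : Matrix Q Q ℂ, ptraceSnd (applyKraus E ρ) = ρ.trace • σ) (p q : Q) (a b : U) :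
    ∑ k : ιE × S, E k.1 (a, k.2) p * star (E k.1 (b, k.2) q) = if p = q then σ a b else 0 := by
  have h := congrFun (congrFun (hsec (Matrix.single p q 1)) a) b
  simp only [ptraceSnd, Matrix.of_apply, applyKraus_single_apply, Matrix.smul_apply,
    smul_eq_mul] at h
  rw [Fintype.sum_prod_type, Finset.sum_comm, h]
  split_ifs with hpq
  · simp [hpq]
  · simp [Matrix.trace_single_eq_of_ne _ _ _ hpq]

/-- The `S`-blocks of every Kraus operator have their columns in the range of the marginal. -/
lemma block_mem_range_of_ptraceSnd_eq (E : ιE → Matrix (U × S) Q ℂ) (σ : Matrix U U ℂ)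
    (hsec : ∀ ρ : Matrix Q Q ℂ, ptraceSnd (applyKraus E ρ) = ρ.trace • σ) (i : ιE) (s : S)
    (q : Q) : (fun u => E i (u, s) q) ∈ LinearMap.range σ.mulVecLin := by
  classical
  let B : Matrix U (ιE × S) ℂ := Matrix.of fun u k => E k.1 (u, k.2) q
  have hB : σ = B * Bᴴ := by
    ext a b
    have := sum_mul_star_eq_of_ptraceSnd_eq E σ hsec q q a b
    simpa [B, Matrix.mul_apply] using this.symm
  rw [hB, range_mulVecLin_self_mul_conjTranspose]
  exact ⟨Pi.single (i, s) 1, by ext u; simp [B]⟩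

/-- Rank form of the bound `S(RU) ≤ S(RUS) + log dim S`. -/
lemma card_mul_rank_marginal_le (E : ιE → Matrix (U × S) Q ℂ) (σ : Matrix U U ℂ)
    (hsec : ∀ ρ : Matrix Q Q ℂ, ptraceSnd (applyKraus E ρ) = ρ.trace • σ) :
    Fintype.card Q * σ.rank ≤
      Fintype.card S * Module.finrank ℂ (Submodule.span ℂ (Set.range E)) := by
  classical
  let V := Submodule.span ℂ (Set.range E)
  let g : (S → V) →ₗ[ℂ] (Q → U → ℂ) :=
    { toFun := fun A q u => ∑ s, (A s : Matrix (U × S) Q ℂ) (u, s) q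
      map_add' := fun A B => by ext; simp [Finset.sum_add_distrib]
      map_smul' := fun c A => by ext; simp [Finset.mul_sum] }
  let f : (Q → LinearMap.range σ.mulVecLin) →ₗ[ℂ] (Q → U → ℂ) :=
    { toFun := fun v q => v q
      map_add' := fun _ _ => rfl
      map_smul' := fun _ _ => rfl }
  have hf : Function.Injective f := fun v w h => by
    ext q u
    exact congrFun (congrFun h q) u
  have hblock (k : ιE × S) : (fun q u => E k.1 (u, k.2) q) ∈ LinearMap.range g := by
    refine ⟨Pi.single k.2 ⟨E k.1, Submodule.subset_span ⟨k.1, rfl⟩⟩, ?_⟩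
    ext q u
    change ∑ s, ((Pi.single k.2 _ : S → V) s : Matrix (U × S) Q ℂ) (u, s) q = _
    rw [Finset.sum_eq_single k.2]
    · simp
    · intro s _ hs
      simp [hs]
    · simp
  have hle : LinearMap.range f ≤ LinearMap.range g := by
    rintro _ ⟨v, rfl⟩
    choose x hx using fun q => (v q).2
    have : f v = ∑ k : ιE × S,
        (∑ q, ∑ b, star (E k.1 (b, k.2) q) * x q b) • fun q u => E k.1 (u, k.2) q := by
      ext p a
      have hv : f v p a = ∑ b, σ a b * x p b := (congrFun (hx p) a).symm
      have hterm (q : Q) (b : U) :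
          ∑ k : ιE × S, star (E k.1 (b, k.2) q) * x q b * E k.1 (a, k.2) p =
            if p = q then σ a b * x q b else 0 := by
        rw [← ite_zero_mul, ← sum_mul_star_eq_of_ptraceSnd_eq E σ hsec, Finset.sum_mul]
        exact Finset.sum_congr rfl fun _ _ => by ring
      simp only [hv, Finset.sum_apply, Pi.smul_apply, smul_eq_mul, Finset.sum_mul]
      rw [Finset.sum_comm]
      simp_rw [Finset.sum_comm (s := (Finset.univ : Finset (ιE × S))) (t := Finset.univ (α := U)),
        hterm]
      rw [Finset.sum_comm]
      simp
    rw [this]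
    exact Submodule.sum_mem _ fun k _ => Submodule.smul_mem _ _ (hblock k)
  calc Fintype.card Q * σ.rank
      = Module.finrank ℂ (Q → LinearMap.range σ.mulVecLin) := by
        simp [Module.finrank_pi_fintype, Matrix.rank]
    _ = Module.finrank ℂ (LinearMap.range f) := (LinearMap.finrank_range_of_inj hf).symm
    _ ≤ Module.finrank ℂ (LinearMap.range g) := Submodule.finrank_mono hle
    _ ≤ Module.finrank ℂ (S → V) := LinearMap.finrank_range_le g
    _ = Fintype.card S * Module.finrank ℂ V := by simp [Module.finrank_pi_fintype]

/-- Rank form of the bound `S(US) ≤ S(U) + log dim S`. -/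
lemma card_mul_finrank_span_le [DecidableEq U] [DecidableEq S] [Nonempty Q]
    (E : ιE → Matrix (U × S) Q ℂ)
    (D : ιD → Matrix Q (U × S) ℂ) (hD : ∑ i, (D i)ᴴ * D i = 1)
    (hdec : ∀ ρ : Matrix Q Q ℂ, applyKraus D (applyKraus E ρ) = ρ)
    (σ : Matrix U U ℂ)
    (hsec : ∀ ρ : Matrix Q Q ℂ, ptraceSnd (applyKraus E ρ) = ρ.trace • σ) :
    Fintype.card Q * Module.finrank ℂ (Submodule.span ℂ (Set.range E)) ≤
      Fintype.card S * σ.rank := by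
  let V := Submodule.span ℂ (Set.range E)
  have hscalar (A : V) (j : ιD) : ∃ c : ℂ, D j * A.1 = c • (1 : Matrix Q Q ℂ) := by
    obtain ⟨A, hA⟩ := A
    induction hA using Submodule.span_induction with
    | mem _ h =>
      obtain ⟨i, rfl⟩ := h
      exact exists_eq_smul_one_of_applyKraus_eq_self (fun k : ιD × ιE => D k.1 * E k.2)
        (fun ρ => by rw [← applyKraus_comp, hdec]) (j, i)
    | zero => exact ⟨0, by simp⟩
    | add _ _ _ _ hx hy =>
      obtain ⟨c, hc⟩ := hx
      obtain ⟨d, hd⟩ := hy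
      exact ⟨c + d, by simp_all [Matrix.mul_add, add_smul]⟩
    | smul a _ _ hx =>
      obtain ⟨c, hc⟩ := hx
      exact ⟨a * c, by simp_all [mul_smul]⟩
  have hcol (A : V) (s : S) (q : Q) :
      (fun u => A.1 (u, s) q) ∈ LinearMap.range σ.mulVecLin := by
    obtain ⟨A, hA⟩ := A
    induction hA using Submodule.span_induction with
    | mem _ h =>
      obtain ⟨i, rfl⟩ := h
      exact block_mem_range_of_ptraceSnd_eq E σ hsec i s q
    | zero => exact Submodule.zero_mem _
    | add _ _ _ _ hx hy => exact Submodule.add_mem _ hx hy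
    | smul a _ _ hx => exact Submodule.smul_mem _ a hx
  let g : (Q → V) →ₗ[ℂ] (S → LinearMap.range σ.mulVecLin) :=
    { toFun := fun A s => ∑ q, ⟨fun u => (A q).1 (u, s) q, hcol (A q) s q⟩
      map_add' := fun A B => by ext; simp [Finset.sum_add_distrib]
      map_smul' := fun c A => by ext; simp [Finset.mul_sum] }
  have hg : Function.Injective g := by
    rw [injective_iff_map_eq_zero]
    intro A hA
    have hsum (x : U × S) : ∑ q, (A q).1 x q = 0 := by
      simpa [g] using congrFun (congrArg Subtype.val (congrFun hA x.2)) x.1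
    have hDA (j : ιD) (p : Q) : D j * (A p).1 = 0 := by
      choose c hc using fun q => hscalar (A q) j
      have : c p = ∑ q, (D j * (A q).1) p q := by simp [hc, Matrix.one_apply]
      rw [hc, this]
      simp only [Matrix.mul_apply]
      rw [Finset.sum_comm]
      simp [← Finset.mul_sum, hsum]
    ext1 p
    apply Subtype.ext
    calc (A p).1 = (∑ j, (D j)ᴴ * D j) * (A p).1 := by rw [hD, Matrix.one_mul]
      _ = 0 := by simp [Matrix.sum_mul, Matrix.mul_assoc, hDA]
  simpa [Module.finrank_pi_fintype, Matrix.rank] using LinearMap.finrank_le_finrank_of_injective hg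

end SecretSharing

/-- **Significant shares are large.** Let `E` be a (Kraus-form, trace-preserving)
encoding channel from a secret system `Q` into `U ⊗ S` such that (i) there is a
trace-preserving decoding channel `D` from `U ⊗ S` recovering every input state
exactly, and (ii) the marginal of the encoding on `U` is a constant channel
(independent of the input). Then `dim S ≥ dim Q`. -/
theorem significant_share_dim_bound
    {Q U S : Type*} [Fintype Q] [Fintype U] [Fintype S]
    [DecidableEq Q] [DecidableEq U] [DecidableEq S] [Nonempty Q]
    {ιE ιD : Type*} [Fintype ιE] [Fintype ιD]
    (E : ιE → Matrix (U × S) Q ℂ) (hE : ∑ i, (E i)ᴴ * E i = 1)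
    (D : ιD → Matrix Q (U × S) ℂ) (hD : ∑ i, (D i)ᴴ * D i = 1)
    (hdec : ∀ ρ : Matrix Q Q ℂ, applyKraus D (applyKraus E ρ) = ρ)
    (σ : Matrix U U ℂ)
    (hsec : ∀ ρ : Matrix Q Q ℂ, ptraceSnd (applyKraus E ρ) = ρ.trace • σ) :
    Fintype.card Q ≤ Fintype.card S := by
  have hsupp := card_mul_rank_marginal_le E σ hsec
  have hdim := card_mul_finrank_span_le E D hD hdec σ hsec
  have hpos : 0 < Module.finrank ℂ (Submodule.span ℂ (Set.range E)) := by
    rw [Module.finrank_pos_iff_exists_ne_zero]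
    by_contra! h
    have hzero (i : ιE) : E i = 0 :=
      congrArg Subtype.val (h ⟨E i, Submodule.subset_span ⟨i, rfl⟩⟩)
    simp [hzero] at hE
  by_contra! hlt
  have hQ : 0 < Fintype.card Q := Fintype.card_pos
  nlinarith [Nat.mul_le_mul_left (Fintype.card Q) hdim,
    Nat.mul_le_mul_left (Fintype.card S) hsupp,
    Nat.mul_lt_mul_of_pos_right (Nat.mul_self_lt_mul_self hlt) hpos]

end
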